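/- arXiv:1712.04059 — 2 statements merged into one kernel-verified Lean document; each statement's English description precedes it below -/
import Mathlib

section
/- Let G = (V, E) be a finite simple graph and let t : E → ℝ satisfy: t_e ≥ 0 for every edge e; Σ_{e ∈ δ(v)} t_e ≤ 1 for every vertex v; and Σ_{e ∈ E(O)} t_e ≤ (|O| − 1)/2 for every vertex set O ⊆ V of odd cardinality. Then there exist matchings M_1, …, M_N of G and reals t_1, …, t_N ≥ 0 with Σ_{i=1}^N t_i ≤ 1 such that t_e = Σ_{i : e ∈ M_i} t_i for every edge e; that is, t is the link-time vector of a feasible unit-time schedule. -/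
/-- `M` is a matching of the simple graph `G`: a set of edges of `G`,
no two of which share a vertex. -/
def IsMatchingOf {V : Type*} (G : SimpleGraph V) (M : Finset (Sym2 V)) : Prop :=
  (∀ e ∈ M, e ∈ G.edgeSet) ∧ ∀ e ∈ M, ∀ f ∈ M, e ≠ f → ∀ v, v ∈ e → v ∉ f

open Finset in
theorem orbit_aux {V : Type*} (m n : V → V) (hm : ∀ v, m (m v) = v) (hn : ∀ v, n (n v) = v)
    (τ : V) (hτ : m τ = τ) :
    ∃ S : Set V, τ ∈ S ∧ (∀ x ∈ S, m x ∈ S) ∧ (∀ x ∈ S, n x ∈ S) ∧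
      ∀ x ∈ S, ∀ y ∈ S, n x = x → n y = y → x = y := by
  let a : Equiv.Perm V := Function.Involutive.toPerm m hm
  let b : Equiv.Perm V := Function.Involutive.toPerm n hn
  have ha : ∀ x, a x = m x := fun x => rfl
  have hb : ∀ x, b x = n x := fun x => rfl
  have haa : a * a = 1 := by ext x; simp [ha, hm]
  have hbb : b * b = 1 := by ext x; simp [hb, hn]
  have ha' : a⁻¹ = a := inv_eq_of_mul_eq_one_left haa
  have hb' : b⁻¹ = b := inv_eq_of_mul_eq_one_left hbb
  set g : Equiv.Perm V := a * b with hg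
  have hconj : ∀ k : ℤ, a * g ^ k * a⁻¹ = g ^ (-k) := by
    intro k
    rw [← conj_zpow, zpow_neg, ← inv_zpow]
    congr 1
    rw [hg, mul_inv_rev, ← mul_assoc, haa, hb', one_mul]
  have hmk : ∀ k : ℤ, m ((g ^ k) τ) = (g ^ (-k)) τ := by
    intro k
    rw [← hconj k, ha']
    simp [ha, hτ]
  have hnk : ∀ k : ℤ, n ((g ^ k) τ) = (g ^ (-(k+1))) τ := by
    intro k
    rw [← hmk, add_comm, zpow_add]
    simp [hg, ha, hb, hm]
  refine ⟨{x | ∃ k : ℤ, (g ^ k) τ = x}, ⟨0, by simp⟩, ?_, ?_, ?_⟩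
  · rintro _ ⟨k, rfl⟩; exact ⟨_, (hmk k).symm⟩
  · rintro _ ⟨k, rfl⟩; exact ⟨_, (hnk k).symm⟩
  · rintro _ ⟨k, rfl⟩ _ ⟨l, rfl⟩ h1 h2
    rw [hnk] at h1 h2
    let H : Subgroup (Equiv.Perm V) := MulAction.stabilizer (Equiv.Perm V) τ
    have key : ∀ i j : ℤ, (g ^ i) τ = (g ^ j) τ ↔ g ^ (j - i) ∈ H := by
      intro i j
      rw [MulAction.mem_stabilizer_iff, sub_eq_neg_add, zpow_add, zpow_neg, Equiv.Perm.smul_def,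
        Equiv.Perm.mul_apply, Equiv.Perm.inv_eq_iff_eq]
      exact eq_comm
    rw [key] at h1 h2 ⊢
    have e1 := H.zpow_mem h1 (l - k)
    have e2 := H.mul_mem h2 (H.inv_mem h1)
    have e3 := H.zpow_mem e2 (-k)
    have e4 := H.mul_mem e1 e3
    rw [← zpow_neg, ← zpow_add, ← zpow_mul, ← zpow_mul, ← zpow_add] at e4
    convert e4 using 2
    ring

def SuppInv {V : Type*} (w : V → V → ℕ) (m : V → V) : Prop :=
  (∀ v, m (m v) = v) ∧ ∀ v, m v ≠ v → 0 < w v (m v)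

theorem SuppInv.mono {V : Type*} {w w' : V → V → ℕ} {m : V → V} (h : SuppInv w m)
    (hw : ∀ x y, w x y ≤ w' x y) : SuppInv w' m :=
  ⟨h.1, fun v hv => lt_of_lt_of_le (h.2 v hv) (hw _ _)⟩

theorem even_sum_inv {V : Type*} [Fintype V] (w : V → V → ℕ)
    (hs : ∀ x y, w x y = w y x) (hd : ∀ x, w x x = 0) (m : V → V) (hm : ∀ v, m (m v) = v) :
    Even (∑ v, w v (m v)) := by
  classical
  rw [← ZMod.natCast_eq_zero_iff_even]
  push_cast
  refine Finset.sum_involution (fun v _ => m v) ?_ ?_ (by simp) (by simp [hm])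
  · intro v _
    rw [hm, hs (m v) v, CharTwo.add_self_eq_zero]
  · intro v _ h1 h2
    rw [h2, hd] at h1
    simp at h1

open Classical in
theorem swap_inv {V : Type*} {w : V → V → ℕ} {m n : V → V} (hm : SuppInv w m) (hn : SuppInv w n)
    (S : Set V) (h1 : ∀ x ∈ S, m x ∈ S) (h2 : ∀ x ∈ S, n x ∈ S) :
    SuppInv w (fun v => if v ∈ S then m v else n v) := by
  refine ⟨fun v => ?_, fun v => ?_⟩
  · by_cases h : v ∈ S
    · simp [h, h1 v h, hm.1]
    · have : n v ∉ S := fun h' => h (by simpa [hn.1] using h2 _ h')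
      simp [h, this, hn.1]
  · by_cases h : v ∈ S
    · simpa [h] using hm.2 v
    · simpa [h] using hn.2 v

open Classical in
theorem swap_lemma {V : Type*} [Fintype V] {w : V → V → ℕ} {m n : V → V}
    (hm : SuppInv w m) (hn : SuppInv w n)
    (hmax : ∀ p, SuppInv w p → ∑ v, w v (p v) ≤ ∑ v, w v (m v))
    (O : Finset V) (τ : V) (hτO : τ ∈ O) (hτ : m τ = τ) :
    ∃ n', SuppInv w n' ∧ n' τ = τ ∧ (∑ v, w v (n v) ≤ ∑ v, w v (n' v)) ∧
      (O.filter (fun v => n v = v)).card ≤ (O.filter (fun v => n' v = v)).card ∧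
      (∀ x y, n x = x → n y = y → x ≠ y → n' x = x ∨ n' y = y) := by
  obtain ⟨S, hS, hSm, hSn, hu⟩ := orbit_aux m n hm.1 hn.1 τ hτ
  refine ⟨_, swap_inv hm hn S hSm hSn, by simp [hS, hτ], ?_, ?_, ?_⟩
  · have h1 := hmax _ (swap_inv hn hm S hSn hSm)
    have h2 : ∑ v, w v (if v ∈ S then m v else n v) + ∑ v, w v (if v ∈ S then n v else m v)
        = ∑ v, w v (n v) + ∑ v, w v (m v) := by
      rw [← Finset.sum_add_distrib, ← Finset.sum_add_distrib]
      refine Finset.sum_congr rfl fun v _ => ?_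
      split_ifs <;> omega
    omega
  · set F := O.filter (fun v => n v = v)
    set F' := O.filter (fun v => (if v ∈ S then m v else n v) = v) with hF'
    have hτF : τ ∈ F' := by simp [hF', hτO, hS, hτ]
    have h1 : (F.filter (fun v => v ∈ S)).card ≤ 1 := by
      rw [Finset.card_le_one]
      intro a ha b hb
      simp only [F, Finset.mem_filter] at ha hb
      exact hu a ha.2 b hb.2 ha.1.2 hb.1.2
    have h2 : (F.filter (fun v => v ∉ S)).card ≤ (F'.erase τ).card := by
      apply Finset.card_le_card
      intro v hv
      simp only [F, Finset.mem_filter] at hv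
      simp only [hF', Finset.mem_erase, Finset.mem_filter, hv.2, if_false]
      exact ⟨fun h => hv.2 (h ▸ hS), hv.1⟩
    have h3 := Finset.card_filter_add_card_filter_not (s := F) (fun v => v ∈ S)
    rw [Finset.card_erase_of_mem hτF] at h2
    have := Finset.card_pos.2 ⟨τ, hτF⟩
    omega
  · intro x y hx hy hxy
    by_contra! hc
    by_cases h1 : x ∈ S
    · by_cases h2 : y ∈ S
      · exact hxy (hu x h1 y h2 hx hy)
      · simp [h2, hy] at hc
    · simp [h1, hx] at hc

open Classical in
theorem exists_max_supp {V : Type*} [Fintype V] (f : (V → V) → ℕ) (P : (V → V) → Prop)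
    (hP : ∃ m, P m) : ∃ m, P m ∧ ∀ p, P p → f p ≤ f m := by
  obtain ⟨m0, h0⟩ := hP
  obtain ⟨m, hm, hmax⟩ := Finset.exists_max_image (Finset.univ.filter P) f ⟨m0, by simp [h0]⟩
  exact ⟨m, by simpa using hm, fun p hp => hmax p (by simp [hp])⟩

open Classical in
theorem add_edge {V : Type*} {w : V → V → ℕ} (hs : ∀ x y, w x y = w y x)
    {n : V → V} (hn : SuppInv w n) (u v : V)
    (hw : 0 < w u v) (hu : n u = u) (hv : n v = v) :
    SuppInv w (fun x => if x = u then v else if x = v then u else n x) := by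
  refine ⟨fun x => ?_, fun x => ?_⟩
  · by_cases h1 : x = u
    · subst h1; by_cases h2 : v = x <;> simp [h2]
    · by_cases h2 : x = v
      · subst h2; simp [h1]
      · have h3 : n x ≠ u := fun h => h1 (by rw [← hn.1 x, h, hu])
        have h4 : n x ≠ v := fun h => h2 (by rw [← hn.1 x, h, hv])
        simp [h1, h2, h3, h4, hn.1]
  · by_cases h1 : x = u
    · subst h1; simp [hw]
    · by_cases h2 : x = v
      · subst h2; simp [h1, hs x u, hw]
      · simpa [h1, h2] using hn.2 x

open Classical in
/-- The main step: when every vertex of the component `O` is missed by some maximum matching. -/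
theorem comp_case {V : Type*} [Fintype V] {w : V → V → ℕ}
    (hs : ∀ x y, w x y = w y x) (hd : ∀ x, w x x = 0)
    (O : Finset V) (a : V) (hO : ∀ x, x ∈ O ↔ Relation.ReflTransGen (fun x y => 0 < w x y) a x)
    (hmiss : ∀ u ∈ O, ∃ m, SuppInv w m ∧ (∀ p, SuppInv w p → ∑ v, w v (p v) ≤ ∑ v, w v (m v)) ∧
      m u = u) :
    Odd O.card ∧ ∃ n, SuppInv w n ∧ ∀ p, SuppInv w p →
      (∑ v, (if v ∈ O ∧ p v ∈ O then w v (p v) - 1 else w v (p v))) + O.card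
        ≤ ∑ v, w v (n v) + 1 := by
  set W' : (V → V) → ℕ := fun p => ∑ v, (if v ∈ O ∧ p v ∈ O then w v (p v) - 1 else w v (p v)) with hW'
  set fx : (V → V) → ℕ := fun p => (O.filter (fun v => p v = v)).card with hfx
  have hcl : ∀ x y, x ∈ O → 0 < w x y → y ∈ O := by
    intro x y hx hxy
    rw [hO] at hx ⊢
    exact hx.tail hxy
  have hclm : ∀ p, SuppInv w p → ∀ x ∈ O, p x ∈ O := by
    intro p hp x hx
    by_cases h : p x = x
    · rwa [h]
    · exact hcl _ _ hx (hp.2 x h)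
  have hrel : ∀ p, SuppInv w p → W' p + O.card = ∑ v, w v (p v) + fx p := by
    intro p hp
    have e1 : O.card = ∑ v, if v ∈ O then 1 else 0 := by simp
    have e2 : fx p = ∑ v, if v ∈ O ∧ p v = v then 1 else 0 := by
      simp only [hfx, Finset.card_filter, ← Finset.sum_filter]
      simp only [Finset.sum_filter]
      rw [← Finset.sum_subset (Finset.subset_univ O)]
      · exact Finset.sum_congr rfl fun x hx => by simp [hx]
      · intro x _ hx; simp [hx]
    rw [e1, e2, hW', ← Finset.sum_add_distrib, ← Finset.sum_add_distrib]
    refine Finset.sum_congr rfl fun v _ => ?_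
    by_cases h : v ∈ O
    · have := hclm p hp v h
      by_cases h2 : p v = v
      · simp [h, h2, hd]
      · have := hp.2 v h2
        simp only [h, hclm p hp v h, h2, and_self, and_false, if_true, if_false]
        omega
    · simp [h]
  have hid : SuppInv w (fun x => x) := ⟨by simp, by simp⟩
  obtain ⟨n0, hn0, hn0max⟩ := exists_max_supp W' (SuppInv w) ⟨_, hid⟩
  obtain ⟨n, ⟨hn, hnW⟩, hnmin⟩ := exists_max_supp (fun p => O.card - fx p)
    (fun p => SuppInv w p ∧ W' p = W' n0) ⟨n0, hn0, rfl⟩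
  have hfxO : ∀ p, fx p ≤ O.card := fun p => Finset.card_filter_le _ _
  set Opt : (V → V) → Prop := fun p => SuppInv w p ∧ W' p = W' n0 ∧ fx p = fx n with hOpt
  have hmin : ∀ p, SuppInv w p → W' n0 ≤ W' p → fx n ≤ fx p := by
    intro p hp h
    have := hnmin p ⟨hp, le_antisymm (hn0max p hp) h⟩
    have := hfxO p
    have := hfxO n
    omega
  have hOptn : Opt n := ⟨hn, hnW, rfl⟩
  -- swap
  have hswap : ∀ p, Opt p → ∀ τ ∈ O, ∃ p', Opt p' ∧ p' τ = τ ∧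
      (∀ x y, p x = x → p y = y → x ≠ y → p' x = x ∨ p' y = y) := by
    intro p hp τ hτ
    obtain ⟨m, hm, hmax, hmτ⟩ := hmiss τ hτ
    obtain ⟨p', hp', h1, h2, h3, h4⟩ := swap_lemma hm hp.1 hmax O τ hτ hmτ
    refine ⟨p', ⟨hp', ?_⟩, h1, h4⟩
    have r1 := hrel p hp.1
    have r2 := hrel p' hp'
    have r3 := hn0max p' hp'
    have r4 := hp.2.1
    have r5 := hp.2.2
    change fx p ≤ fx p' at h3
    constructor <;> omega
  -- adjacency
  have hadj : ∀ p, Opt p → ∀ u ∈ O, ∀ v ∈ O, 0 < w u v → p u = u → p v = v → False := by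
    intro p hp u hu v hv huv hpu hpv
    have huv' : u ≠ v := by rintro rfl; simp [hd] at huv
    have hq := add_edge hs hp.1 u v huv hpu hpv
    set q := (fun x => if x = u then v else if x = v then u else p x) with hqd
    have h1 : W' p ≤ W' q := by
      refine Finset.sum_le_sum fun x _ => ?_
      by_cases h1 : x = u
      · subst h1; simp [hpu, hd]
      · by_cases h2 : x = v
        · subst h2; simp [hpv, hd]
        · simp [hqd, h1, h2]
    have h2 : fx q < fx p := by
      apply Finset.card_lt_card
      refine ⟨fun x hx => ?_, fun hx => ?_⟩
      · simp only [Finset.mem_filter, hqd] at hx ⊢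
        refine ⟨hx.1, ?_⟩
        have := hx.2
        split_ifs at this with h1 h2
        · exact absurd (this.trans h1) (Ne.symm huv')
        · exact absurd (this.trans h2) huv'
        · exact this
      · have := hx (Finset.mem_filter.2 ⟨hu, hpu⟩)
        simp [hqd] at this
        exact huv' this.2.symm
    have := hmin q hq (hp.2.1 ▸ h1)
    have := hp.2.2
    omega
  have huniq : ∀ v ∈ O, ∀ u, Relation.ReflTransGen (fun x y => 0 < w x y) u v → u ∈ O →
      ∀ p, Opt p → p u = u → p v = v → u = v := by
    intro v hv u huv
    induction huv using Relation.ReflTransGen.head_induction_on with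
    | refl => intros; rfl
    | @head u x hux hxv ih =>
      intro hu p hp hpu hpv
      by_contra hne
      have hx := hcl _ _ hu hux
      obtain ⟨p', hp', h1, h2⟩ := hswap p hp x hx
      rcases h2 u v hpu hpv hne with h | h
      · exact hadj p' hp' u hu x hx hux h h1
      · have := ih hx p' hp' h1 h
        subst this
        exact hadj p hp u hu x hx hux hpu hpv
  have hsymm : ∀ u ∈ O, Relation.ReflTransGen (fun x y => 0 < w x y) u a := by
    intro u hu
    rw [hO] at hu
    have hsy : Std.Symm (fun x y => 0 < w x y) := ⟨fun x y h => by rw [hs]; exact h⟩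
    exact Relation.ReflTransGen.stdSymm.symm _ _ hu
  have hfx1 : fx n = 1 := by
    apply le_antisymm
    · rw [hfx, Finset.card_le_one]
      intro x hx y hy
      simp only [Finset.mem_filter] at hx hy
      exact huniq y hy.1 x ((hsymm x hx.1).trans ((hO y).1 hy.1)) hx.1 n hOptn hx.2 hy.2
    · have haO : a ∈ O := (hO a).2 .refl
      obtain ⟨p', hp', h1, h2⟩ := hswap n hOptn a haO
      rw [← hp'.2.2]
      exact Finset.card_pos.2 ⟨a, by simp [haO, h1]⟩
  refine ⟨?_, n, hn, fun p hp => ?_⟩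
  · have h3 := Finset.card_filter_add_card_filter_not (s := O) (fun v => n v = v)
    have h4 : Even (O.filter (fun v => ¬ n v = v)).card := by
      rw [← ZMod.natCast_eq_zero_iff_even, Finset.card_eq_sum_ones]
      push_cast
      refine Finset.sum_involution (fun v _ => n v) ?_ ?_ ?_ (by simp [hn.1])
      · intro v _; exact CharTwo.add_self_eq_zero _
      · intro v hv _; exact (Finset.mem_filter.1 hv).2
      · intro v hv
        rw [Finset.mem_filter] at hv ⊢
        exact ⟨hclm n hn v hv.1, fun h => hv.2 (by rw [hn.1] at h; exact h.symm)⟩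
    change fx n + _ = _ at h3
    rw [hfx1] at h3
    rw [← h3]
    exact h4.one_add
  · have r1 := hrel n hn
    have r2 := hn0max p hp
    change W' p + _ ≤ _
    omega

open Classical in
theorem core {V : Type*} [Fintype V] (t : V → V → ℝ) (ht : ∀ x y, 0 ≤ t x y)
    (hts : ∀ x y, t x y = t y x) (hnode : ∀ v, ∑ u, t v u ≤ 1)
    (hodd : ∀ O : Finset V, Odd O.card → ∑ x ∈ O, ∑ y ∈ O, t x y ≤ (O.card : ℝ) - 1) :
    ∀ (k : ℕ) (w : V → V → ℕ), (∑ x, ∑ y, w x y = k) → (∀ x y, w x y = w y x) → (∀ x, w x x = 0) →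
      ∃ m, SuppInv w m ∧ ∑ x, ∑ y, (w x y : ℝ) * t x y ≤ ((∑ v, w v (m v) : ℕ) : ℝ) := by
  intro k
  induction k using Nat.strong_induction_on with
  | _ k ih =>
  intro w hk hs hd
  have hid : SuppInv w (fun x => x) := ⟨by simp, by simp⟩
  by_cases hz : ∀ x y, w x y = 0
  · exact ⟨_, hid, by simp [hz]⟩
  push Not at hz
  obtain ⟨a, b, hab⟩ := hz
  set O : Finset V := Finset.univ.filter
    (fun x => Relation.ReflTransGen (fun x y => 0 < w x y) a x) with hOdef
  have hO : ∀ x, x ∈ O ↔ Relation.ReflTransGen (fun x y => 0 < w x y) a x := by simp [hOdef]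
  have hlt : ∀ w' : V → V → ℕ, (∀ x y, w' x y ≤ w x y) → (∃ x y, w' x y < w x y) →
      ∑ x, ∑ y, w' x y < k := by
    rintro w' h1 ⟨x, y, h2⟩
    rw [← hk]
    refine Finset.sum_lt_sum (fun x _ => Finset.sum_le_sum fun y _ => h1 x y) ⟨x, Finset.mem_univ _, ?_⟩
    exact Finset.sum_lt_sum (fun y _ => h1 x y) ⟨y, Finset.mem_univ _, h2⟩
  by_cases hmiss : ∀ u ∈ O, ∃ m, SuppInv w m ∧
      (∀ p, SuppInv w p → ∑ v, w v (p v) ≤ ∑ v, w v (m v)) ∧ m u = u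
  · obtain ⟨hoddO, n, hn, hmax⟩ := comp_case hs hd O a hO hmiss
    set w' : V → V → ℕ := fun x y => if x ∈ O ∧ y ∈ O then w x y - 1 else w x y with hw'
    have hle : ∀ x y, w' x y ≤ w x y := by intro x y; simp only [hw']; split_ifs <;> omega
    have haO : a ∈ O := (hO a).2 .refl
    have hbO : b ∈ O := (hO b).2 (.single (Nat.pos_of_ne_zero hab))
    obtain ⟨m, hm, hmt⟩ := ih _ (hlt w' hle ⟨a, b, by simp [hw', haO, hbO]; omega⟩) w' rfl
      (by intro x y; simp only [hw', hs x y, and_comm]) (by simp [hw', hd])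
    refine ⟨n, hn, ?_⟩
    have h1 := hmax m (hm.mono hle)
    have h2 : ∑ x, ∑ y, (w x y : ℝ) * t x y ≤
        ∑ x, ∑ y, (w' x y : ℝ) * t x y + ∑ x ∈ O, ∑ y ∈ O, t x y := by
      have : ∑ x ∈ O, ∑ y ∈ O, t x y = ∑ x, ∑ y, if x ∈ O ∧ y ∈ O then t x y else 0 := by
        simp only [ite_and]
        rw [← Finset.sum_subset (Finset.subset_univ O) (by intro x _ hx; simp [hx])]
        refine Finset.sum_congr rfl fun x hx => ?_
        simp [hx]
      rw [this, ← Finset.sum_add_distrib]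
      refine Finset.sum_le_sum fun x _ => ?_
      rw [← Finset.sum_add_distrib]
      refine Finset.sum_le_sum fun y _ => ?_
      simp only [hw']
      split_ifs with h
      · have : (w x y : ℝ) ≤ ((w x y - 1 : ℕ) : ℝ) + 1 := by norm_cast; omega
        nlinarith [ht x y]
      · simp
    have h3 := hodd O hoddO
    have h4 : ((∑ v, w' v (m v) : ℕ) : ℝ) + O.card ≤ ((∑ v, w v (n v) : ℕ) : ℝ) + 1 := by
      exact_mod_cast h1
    linarith
  · push Not at hmiss
    obtain ⟨u, hu, hcov⟩ := hmiss
    obtain ⟨n, hn, hmax⟩ := exists_max_supp (fun p => ∑ v, w v (p v)) (SuppInv w) ⟨_, hid⟩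
    have hnu : n u ≠ u := hcov n hn hmax
    set w' : V → V → ℕ := fun x y => if x = u ∨ y = u then w x y - 1 else w x y with hw'
    have hle : ∀ x y, w' x y ≤ w x y := by intro x y; simp only [hw']; split_ifs <;> omega
    have hpos := hn.2 u hnu
    obtain ⟨m, hm, hmt⟩ := ih _ (hlt w' hle ⟨u, n u, by simp [hw']; omega⟩) w' rfl
      (by intro x y; simp only [hw', hs x y, or_comm]) (by simp [hw', hd])
    refine ⟨n, hn, ?_⟩
    have hmw := hm.mono hle
    have h1 : ∑ v, w' v (m v) + 2 ≤ ∑ v, w v (n v) := by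
      by_cases hmu : m u = u
      · have e1 := even_sum_inv w hs hd m hm.1
        have e2 := even_sum_inv w hs hd n hn.1
        have e3 : ∑ v, w v (m v) < ∑ v, w v (n v) := by
          by_contra! hc
          exact hcov m hmw (fun p hp => (hmax p hp).trans hc) hmu
        have e4 : ∑ v, w' v (m v) ≤ ∑ v, w v (m v) := Finset.sum_le_sum fun v _ => hle _ _
        obtain ⟨c, hc⟩ := e1
        obtain ⟨d, hd⟩ := e2
        omega
      · refine le_trans ?_ (hmax m hmw)
        have e0 : (2 : ℕ) = ∑ v, ((if v = u then 1 else 0) + (if v = m u then 1 else 0)) := by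
          rw [Finset.sum_add_distrib]; simp
        rw [e0, ← Finset.sum_add_distrib]
        refine Finset.sum_le_sum fun v _ => ?_
        by_cases h1 : v = u
        · subst h1
          have := hmw.2 v hmu
          simp only [hw', Ne.symm hmu]
          simp
          omega
        · by_cases h2 : v = m u
          · have h5 : m v = u := by rw [h2, hm.1]
            have := hmw.2 v (by rw [h5]; exact Ne.symm h1)
            simp only [hw', h5]
            rw [h5] at this
            simp [h1, ← h2]
            omega
          · simp [h1, h2, hle]
    have h2 : ∑ x, ∑ y, (w x y : ℝ) * t x y ≤
        ∑ x, ∑ y, (w' x y : ℝ) * t x y + (∑ y, t u y + ∑ x, t x u) := by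
      have e1 : ∑ y, t u y = ∑ x, ∑ y, if x = u then t x y else 0 := by
        rw [Finset.sum_comm]; simp
      have e2 : ∑ x, t x u = ∑ x, ∑ y, if y = u then t x y else 0 := by simp
      rw [e1, e2, ← Finset.sum_add_distrib, ← Finset.sum_add_distrib]
      refine Finset.sum_le_sum fun x _ => ?_
      rw [← Finset.sum_add_distrib, ← Finset.sum_add_distrib]
      refine Finset.sum_le_sum fun y _ => ?_
      have h0 := ht x y
      have : (w x y : ℝ) ≤ ((w x y - 1 : ℕ) : ℝ) + 1 := by norm_cast; omega
      simp only [hw']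
      by_cases h1 : x = u <;> by_cases h2 : y = u <;> simp only [h1, h2] at * <;> simp <;> nlinarith
    have h3 := hnode u
    have h3' : ∑ x, t x u ≤ 1 := by simpa only [hts _ u] using h3
    have h4 : ((∑ v, w' v (m v) : ℕ) : ℝ) + 2 ≤ ((∑ v, w v (n v) : ℕ) : ℝ) := by
      exact_mod_cast h1
    linarith

open Classical in
/-- Real-weight version via scaling. -/
theorem core_real {V : Type*} [Fintype V] (t : V → V → ℝ) (ht : ∀ x y, 0 ≤ t x y)
    (hts : ∀ x y, t x y = t y x) (hnode : ∀ v, ∑ u, t v u ≤ 1)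
    (hodd : ∀ O : Finset V, Odd O.card → ∑ x ∈ O, ∑ y ∈ O, t x y ≤ (O.card : ℝ) - 1)
    (c : V → V → ℝ) (hc0 : ∀ x y, 0 ≤ c x y) (hcs : ∀ x y, c x y = c y x) (hcd : ∀ x, c x x = 0)
    (B : ℝ) (hB : ∀ m : V → V, (∀ v, m (m v) = v) → (∀ v, m v ≠ v → 0 < c v (m v)) →
      ∑ v, c v (m v) ≤ B) :
    ∑ x, ∑ y, c x y * t x y ≤ B := by
  by_contra! hlt
  set T := ∑ x, ∑ y, t x y with hT
  obtain ⟨K, hK⟩ := exists_nat_gt (T / (∑ x, ∑ y, c x y * t x y - B))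
  rw [div_lt_iff₀ (by linarith)] at hK
  have hTn : 0 ≤ T := Finset.sum_nonneg fun x _ => Finset.sum_nonneg fun y _ => ht x y
  set w : V → V → ℕ := fun x y => ⌊(K : ℝ) * c x y⌋₊ with hw
  obtain ⟨m, hm, hmt⟩ := core t ht hts hnode hodd _ w rfl (by intro x y; simp only [hw, hcs x y])
    (by simp [hw, hcd])
  have hwle : ∀ x y, (w x y : ℝ) ≤ K * c x y := fun x y =>
    Nat.floor_le (mul_nonneg (Nat.cast_nonneg _) (hc0 x y))
  have h1 : ((∑ v, w v (m v) : ℕ) : ℝ) ≤ K * B := by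
    push_cast
    calc ∑ v, (w v (m v) : ℝ) ≤ ∑ v, K * c v (m v) := Finset.sum_le_sum fun v _ => hwle _ _
      _ = K * ∑ v, c v (m v) := by rw [Finset.mul_sum]
      _ ≤ K * B := by
        refine mul_le_mul_of_nonneg_left (hB m hm.1 fun v hv => ?_) (Nat.cast_nonneg _)
        have h2 := hm.2 v hv
        refine lt_of_le_of_ne (hc0 _ _) fun h => ?_
        simp [hw, ← h] at h2
  have h2 : (K : ℝ) * ∑ x, ∑ y, c x y * t x y ≤ ∑ x, ∑ y, (w x y : ℝ) * t x y + T := by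
    rw [hT, Finset.mul_sum, ← Finset.sum_add_distrib]
    refine Finset.sum_le_sum fun x _ => ?_
    rw [Finset.mul_sum, ← Finset.sum_add_distrib]
    refine Finset.sum_le_sum fun y _ => ?_
    have := (Nat.lt_floor_add_one ((K : ℝ) * c x y)).le
    change (K : ℝ) * c x y ≤ w x y + 1 at this
    nlinarith [ht x y]
  nlinarith

open Classical in
theorem hull_mem {V : Type*} [Fintype V] (G : SimpleGraph V)
    (t : V → V → ℝ) (ht : ∀ x y, 0 ≤ t x y)
    (hts : ∀ x y, t x y = t y x) (htG : ∀ x y, ¬ G.Adj x y → t x y = 0)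
    (hnode : ∀ v, ∑ u, t v u ≤ 1)
    (hodd : ∀ O : Finset V, Odd O.card → ∑ x ∈ O, ∑ y ∈ O, t x y ≤ (O.card : ℝ) - 1) :
    (fun q : V × V => t q.1 q.2) ∈ convexHull ℝ (Set.range
      (fun (m : {m : V → V // (∀ v, m (m v) = v) ∧ ∀ v, m v ≠ v → G.Adj v (m v)}) (q : V × V) =>
        if m.1 q.1 = q.2 ∧ q.1 ≠ q.2 then (1 : ℝ) else 0)) := by
  by_contra hnot
  set A := Set.range
      (fun (m : {m : V → V // (∀ v, m (m v) = v) ∧ ∀ v, m v ≠ v → G.Adj v (m v)}) (q : V × V) =>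
        if m.1 q.1 = q.2 ∧ q.1 ≠ q.2 then (1 : ℝ) else 0) with hA
  have hfin : A.Finite := Set.finite_range _
  obtain ⟨f, b, hf1, hf2⟩ := geometric_hahn_banach_closed_point (convex_convexHull ℝ A)
    (hfin.isClosed_convexHull ℝ) hnot
  set d : V → V → ℝ := fun x y => f (Pi.single (x, y) 1) with hdd
  have hf : ∀ z : V × V → ℝ, f z = ∑ x, ∑ y, d x y * z (x, y) := by
    intro z
    conv_lhs => rw [pi_eq_sum_univ' z]
    rw [map_sum, Fintype.sum_prod_type]
    refine Finset.sum_congr rfl fun x _ => Finset.sum_congr rfl fun y _ => ?_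
    rw [map_smul, smul_eq_mul, mul_comm]
  set c : V → V → ℝ := fun x y => if G.Adj x y then max 0 (d x y + d y x) else 0 with hc
  have hmain := core_real t ht hts hnode hodd c
    (by intro x y; simp only [hc]; split_ifs <;> simp)
    (by intro x y; simp only [hc, G.adj_comm x y, add_comm]) (by simp [hc]) (2 * b) ?_
  · rw [hf] at hf2
    have h1 : ∑ x, ∑ y, d x y * t x y = ∑ x, ∑ y, d y x * t x y := by
      rw [Finset.sum_comm]
      refine Finset.sum_congr rfl fun x _ => Finset.sum_congr rfl fun y _ => ?_
      rw [hts]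
    have h2 : ∑ x, ∑ y, d x y * t x y + ∑ x, ∑ y, d y x * t x y ≤ ∑ x, ∑ y, c x y * t x y := by
      rw [← Finset.sum_add_distrib]
      refine Finset.sum_le_sum fun x _ => ?_
      rw [← Finset.sum_add_distrib]
      refine Finset.sum_le_sum fun y _ => ?_
      by_cases h : G.Adj x y
      · simp only [hc, h, if_true]
        rw [← add_mul]
        exact mul_le_mul_of_nonneg_right (le_max_right _ _) (ht x y)
      · simp [htG x y h]
    linarith
  · intro m hm1 hm2
    have hmG : ∀ v, m v ≠ v → G.Adj v (m v) := by
      intro v hv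
      by_contra h
      have := hm2 v hv
      simp [hc, h] at this
    have h1 := hf1 _ (subset_convexHull ℝ A ⟨⟨m, hm1, hmG⟩, rfl⟩)
    rw [hf] at h1
    have h2 : ∑ x, ∑ y, d x y * (if m x = y ∧ x ≠ y then (1 : ℝ) else 0)
        = ∑ x, if m x ≠ x then d x (m x) else 0 := by
      refine Finset.sum_congr rfl fun x _ => ?_
      rw [Finset.sum_eq_single (m x)]
      · simp [eq_comm]
      · intro y _ hy; simp [Ne.symm hy]
      · simp
    have h3 : ∑ x, (if m x ≠ x then d x (m x) else 0) = ∑ x, (if m x ≠ x then d (m x) x else 0) := by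
      rw [← Equiv.sum_comp (Function.Involutive.toPerm m hm1)]
      refine Finset.sum_congr rfl fun x _ => ?_
      change (if m (m x) ≠ m x then d (m x) (m (m x)) else 0) = _
      rw [hm1]
      simp only [ne_comm]
    have h4 : ∑ v, c v (m v) = ∑ x, (if m x ≠ x then d x (m x) else 0)
        + ∑ x, (if m x ≠ x then d (m x) x else 0) := by
      rw [← Finset.sum_add_distrib]
      refine Finset.sum_congr rfl fun x _ => ?_
      by_cases h : m x = x
      · simp [h, hc]
      · have h5 := hm2 x h
        simp only [hc, hmG x h, if_true] at h5
        simp only [hc, hmG x h, if_true, ne_eq, h, not_false_eq_true]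
        rcases le_total 0 (d x (m x) + d (m x) x) with h6 | h6
        · exact max_eq_right h6
        · rw [max_eq_left h6] at h5; exact absurd h5 (lt_irrefl _)
    simp only at h1
    rw [h2] at h1
    rw [h4, ← h3]
    linarith

/-- part (1) of Lemma 1: every point of the schedule polyhedron
is the link-time vector of a feasible unit-time schedule, i.e. if `t` is
nonnegative on edges, satisfies the node constraints and the odd-set
constraints, then there are matchings `M₁,…,M_N` and slot lengths
`s₁,…,s_N ≥ 0` with `∑ s i ≤ 1` whose link-time vector is `t`. -/
theorem schedule_polyhedron_feasible {V : Type*} [Fintype V] [DecidableEq V]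
    (G : SimpleGraph V) [DecidableRel G.Adj] (t : Sym2 V → ℝ)
    (h0 : ∀ e ∈ G.edgeSet, 0 ≤ t e)
    (hnode : ∀ v : V, ∑ e ∈ G.incidenceFinset v, t e ≤ 1)
    (hodd : ∀ O : Finset V, Odd O.card →
      ∑ e ∈ G.edgeFinset.filter (fun e => ∀ u ∈ e, u ∈ O), t e ≤ ((O.card : ℝ) - 1) / 2) :
    ∃ (N : ℕ) (M : Fin N → Finset (Sym2 V)) (s : Fin N → ℝ),
      (∀ i, IsMatchingOf G (M i)) ∧ (∀ i, 0 ≤ s i) ∧ (∑ i, s i ≤ 1) ∧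
      ∀ e ∈ G.edgeSet, t e = ∑ i, if e ∈ M i then s i else 0 := by
  set T : V → V → ℝ := fun x y => if G.Adj x y then t s(x, y) else 0 with hT
  have hmem := hull_mem G T
    (by intro x y; simp only [hT]; split_ifs with h; exacts [h0 _ h, le_rfl])
    (by intro x y; simp only [hT, G.adj_comm x y, Sym2.eq_swap])
    (by intro x y h; simp [hT, h])
    (by
      intro v
      refine le_trans (le_of_eq ?_) (hnode v)
      simp only [hT]
      rw [← Finset.sum_filter]
      refine Finset.sum_bij (fun u _ => s(v, u)) ?_ ?_ ?_ ?_
      · intro u hu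
        simpa [SimpleGraph.mem_incidenceFinset, SimpleGraph.mk'_mem_incidenceSet_iff] using hu
      · intro u _ u' _ h
        exact Sym2.congr_right.1 h
      · intro e he
        rw [SimpleGraph.mem_incidenceFinset] at he
        obtain ⟨he1, he2⟩ := he
        obtain ⟨u, rfl⟩ := he2
        exact ⟨u, by simpa using he1, rfl⟩
      · intros; rfl)
    (by
      intro O hO
      have h1 := hodd O hO
      suffices h : ∑ x ∈ O, ∑ y ∈ O, T x y
          = 2 * ∑ e ∈ G.edgeFinset.filter (fun e => ∀ u ∈ e, u ∈ O), t e by linarith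
      rw [← Finset.sum_product', Finset.mul_sum]
      simp only [hT]
      rw [← Finset.sum_filter]
      rw [← Finset.sum_fiberwise_of_maps_to (g := fun p : V × V => s(p.1, p.2))
        (t := G.edgeFinset.filter (fun e => ∀ u ∈ e, u ∈ O))]
      · refine Finset.sum_congr rfl fun e he => ?_
        induction e using Sym2.ind with
        | _ a b =>
        simp only [Finset.mem_filter, SimpleGraph.mem_edgeFinset, SimpleGraph.mem_edgeSet,
          Sym2.mem_iff, forall_eq_or_imp, forall_eq] at he
        obtain ⟨hab, ha, hb⟩ := he
        have hset : (((O ×ˢ O).filter (fun p : V × V => G.Adj p.1 p.2)).filter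
            (fun p => s(p.1, p.2) = s(a, b))) = {(a, b), (b, a)} := by
          ext ⟨x, y⟩
          simp only [Finset.mem_filter, Finset.mem_product, Sym2.eq_iff, Finset.mem_insert,
            Finset.mem_singleton, Prod.mk.injEq]
          constructor
          · exact fun h => h.2
          · rintro (⟨rfl, rfl⟩ | ⟨rfl, rfl⟩)
            · exact ⟨⟨⟨ha, hb⟩, hab⟩, by simp⟩
            · exact ⟨⟨⟨hb, ha⟩, hab.symm⟩, by simp⟩
        rw [hset, Finset.sum_pair (by intro h; exact hab.ne (Prod.mk.inj h).1)]
        simp only [Sym2.eq_swap (a := b) (b := a)]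
        ring
      · rintro ⟨x, y⟩ h
        simpa [and_comm] using h)
  classical
  rw [convexHull_range_eq_exists_affineCombination] at hmem
  obtain ⟨F, w, hw0, hw1, hx⟩ := hmem
  rw [Finset.affineCombination_eq_linear_combination _ _ _ hw1] at hx
  refine ⟨F.card, fun i => Finset.univ.filter (fun e =>
    ∃ v, (F.equivFin.symm i).1.1 v ≠ v ∧ e = s(v, (F.equivFin.symm i).1.1 v)),
    fun i => w (F.equivFin.symm i).1, fun i => ?_, fun i => hw0 _ (F.equivFin.symm i).2, ?_, ?_⟩
  · beta_reduce
    generalize (F.equivFin.symm i).1 = m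
    obtain ⟨m, hm, hG⟩ := m
    refine ⟨?_, ?_⟩
    · intro e he
      simp only [Finset.mem_filter, Finset.mem_univ, true_and] at he
      obtain ⟨v, hv, rfl⟩ := he
      exact hG v hv
    · intro e he f hf hne v hve hvf
      simp only [Finset.mem_filter, Finset.mem_univ, true_and] at he hf
      have key : ∀ e : Sym2 V, (∃ v, m v ≠ v ∧ e = s(v, m v)) → v ∈ e → e = s(v, m v) := by
        rintro _ ⟨x, _, rfl⟩ h
        rcases Sym2.mem_iff.1 h with rfl | rfl
        · rfl
        · rw [hm, Sym2.eq_swap]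
      exact hne ((key e he hve).trans (key f hf hvf).symm)
  · rw [Equiv.sum_comp F.equivFin.symm (fun x => w x.1), Finset.sum_coe_sort F w, hw1]
  · intro e he
    induction e using Sym2.ind with
    | _ a b =>
    have hab : G.Adj a b := he
    have h1 := congrFun hx (a, b)
    simp only [Finset.sum_apply, Pi.smul_apply, smul_eq_mul, hT, hab, if_true] at h1
    rw [← h1, ← Finset.sum_coe_sort F, ← Equiv.sum_comp F.equivFin.symm]
    refine Finset.sum_congr rfl fun i _ => ?_
    beta_reduce
    generalize (F.equivFin.symm i).1 = m
    obtain ⟨m, hm, hG⟩ := m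
    have hiff : (s(a, b) ∈ Finset.univ.filter (fun e => ∃ v, m v ≠ v ∧ e = s(v, m v)))
        ↔ (m a = b ∧ a ≠ b) := by
      simp only [Finset.mem_filter, Finset.mem_univ, true_and]
      constructor
      · rintro ⟨v, _, h⟩
        rcases Sym2.eq_iff.1 h with ⟨rfl, rfl⟩ | ⟨rfl, rfl⟩
        · exact ⟨rfl, hab.ne⟩
        · exact ⟨hm _, hab.ne⟩
      · rintro ⟨rfl, h⟩
        exact ⟨a, h.symm, rfl⟩
    simp only [hiff, mul_ite, mul_one, mul_zero]
end

section
/- Let T be a finite tree (connected acyclic simple graph) with a distinguished root r, having at least one non-root vertex, and let c_e > 0 be a real capacity for each edge e. For each non-root vertex v, let e_v denote its parent edge (the first edge on the path from v to r), and call e_u a child edge of v if the parent of u is v. Then there exist unique real numbers θ and (t_e)_{e ∈ E(T)} such that Σ_{e ∈ E(T)} t_e = 1 and, for every non-root vertex v, c_{e_v} t_{e_v} − Σ_{e child edge of v} c_e t_e = θ; moreover, θ > 0 and t_e > 0 for every edge e. -/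
/-- initial schedule of the MTFS simplex algorithm: a finite
rooted tree is encoded by its parent map `par` on non-root vertices (each
non-root vertex `v` corresponds to its parent edge `e_v = {v, par v}`), where
a depth function `d`, strictly decreasing along `par`, guarantees that the
parent map encodes a tree rooted at `r`.  Edge capacities are `c v > 0`
(capacity of the parent edge of `v`).  Then there are unique reals `θ` and
`(t_v)` (link time of the parent edge of `v`) with `∑ t_v = 1` and
`c_v t_v - ∑_{u child of v} c_u t_u = θ` for every non-root `v`; moreover any
such `θ` and `t` satisfy `θ > 0` and `t_v > 0` for all `v`. -/
theorem initial_tree_schedule {V : Type*} [Fintype V] [DecidableEq V]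
    (r : V) (par : V → V) (d : V → ℕ)
    (hd : ∀ v : V, v ≠ r → d (par v) < d v)
    (hnr : ∃ v : V, v ≠ r)
    (c : V → ℝ) (hc : ∀ v : V, v ≠ r → 0 < c v) :
    (∃! θt : ℝ × ({v : V // v ≠ r} → ℝ),
      (∑ v : {v : V // v ≠ r}, θt.2 v = 1) ∧
      ∀ v : {v : V // v ≠ r},
        c v.1 * θt.2 v -
          ∑ u ∈ Finset.univ.filter (fun u : {u : V // u ≠ r} => par u.1 = v.1),
            c u.1 * θt.2 u = θt.1) ∧
    ∀ (θ : ℝ) (t : {v : V // v ≠ r} → ℝ),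
      ((∑ v : {v : V // v ≠ r}, t v = 1) ∧
        ∀ v : {v : V // v ≠ r},
          c v.1 * t v -
            ∑ u ∈ Finset.univ.filter (fun u : {u : V // u ≠ r} => par u.1 = v.1),
              c u.1 * t u = θ) →
      0 < θ ∧ ∀ v : {v : V // v ≠ r}, 0 < t v := by
  classical
  obtain ⟨D, hD⟩ : ∃ D, ∀ v, d v ≤ D :=
    ⟨Finset.univ.sup d, fun v => Finset.le_sup (Finset.mem_univ v)⟩
  have wf : WellFounded (fun u v : {v : V // v ≠ r} => par u.1 = v.1) := by
    refine Subrelation.wf (r := InvImage (· < ·) (fun v : {v : V // v ≠ r} => D - d v.1)) ?_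
      (InvImage.wf _ Nat.lt_wfRel.wf)
    intro u v h
    have h1 := hd u.1 u.2
    have h2 := hD u.1
    have h : par u.1 = v.1 := h
    rw [h] at h1
    show D - d u.1 < D - d v.1
    omega
  obtain ⟨N, hN⟩ : ∃ N : {v : V // v ≠ r} → ℝ, ∀ v, N v = 1 +
      ∑ u ∈ Finset.univ.filter (fun u : {u : V // u ≠ r} => par u.1 = v.1), N u := by
    refine ⟨wf.fix (fun v IH => 1 + ∑ u, if h : par u.1 = v.1 then IH u h else 0), fun v => ?_⟩
    rw [wf.fix_eq, Finset.sum_filter]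
    simp only [dite_eq_ite]
  have hpos : ∀ v, 0 < N v := by
    intro v
    induction v using wf.induction with
    | _ v ih =>
      rw [hN]
      have : 0 ≤ ∑ u ∈ Finset.univ.filter (fun u : {u : V // u ≠ r} => par u.1 = v.1), N u :=
        Finset.sum_nonneg fun u hu => (ih u (Finset.mem_filter.1 hu).2).le
      linarith
  have key : ∀ (θ : ℝ) (t : {v : V // v ≠ r} → ℝ),
      (∀ v : {v : V // v ≠ r},
          c v.1 * t v -
            ∑ u ∈ Finset.univ.filter (fun u : {u : V // u ≠ r} => par u.1 = v.1),
              c u.1 * t u = θ) → ∀ v, t v = θ * (N v / c v.1) := by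
    intro θ t h
    have h' : ∀ v, c v.1 * t v = θ * N v := by
      intro v
      induction v using wf.induction with
      | _ v ih =>
        have h1 := h v
        rw [Finset.sum_congr rfl fun u hu => ih u (Finset.mem_filter.1 hu).2,
          ← Finset.mul_sum] at h1
        rw [hN v]
        linarith
    intro v
    have := hc v.1 v.2
    have h2 := h' v
    field_simp
    linarith
  set K : ℝ := ∑ v : {v : V // v ≠ r}, N v / c v.1 with hK
  have hKpos : 0 < K := by
    obtain ⟨v, hv⟩ := hnr
    exact Finset.sum_pos (fun v _ => div_pos (hpos v) (hc v.1 v.2)) ⟨⟨v, hv⟩, Finset.mem_univ _⟩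
  have keyθ : ∀ (θ : ℝ) (t : {v : V // v ≠ r} → ℝ), (∑ v : {v : V // v ≠ r}, t v = 1) →
      (∀ v, t v = θ * (N v / c v.1)) → θ = 1 / K := by
    intro θ t h1 h2
    rw [Finset.sum_congr rfl fun v _ => h2 v, ← Finset.mul_sum] at h1
    exact eq_div_of_mul_eq hKpos.ne' h1
  refine ⟨⟨(1 / K, fun v => 1 / K * (N v / c v.1)), ⟨?_, ?_⟩, ?_⟩, ?_⟩
  · show ∑ v : {v : V // v ≠ r}, 1 / K * (N v / c v.1) = 1
    rw [← Finset.mul_sum]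
    exact one_div_mul_cancel hKpos.ne'
  · intro v
    have e : ∀ u : {v : V // v ≠ r}, c u.1 * (1 / K * (N u / c u.1)) = 1 / K * N u := by
      intro u
      have := (hc u.1 u.2).ne'
      field_simp
    simp only [e]
    rw [← Finset.mul_sum, hN v]
    ring
  · rintro ⟨θ, t⟩ ⟨h1, h2⟩
    have h3 := key θ t h2
    have h4 := keyθ θ t h1 h3
    subst h4
    exact Prod.ext rfl (funext h3)
  · rintro θ t ⟨h1, h2⟩
    have h3 := key θ t h2
    have h4 := keyθ θ t h1 h3
    have h5 : 0 < θ := by rw [h4]; positivity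
    refine ⟨h5, fun v => ?_⟩
    rw [h3]
    exact mul_pos h5 (div_pos (hpos v) (hc v.1 v.2))
end
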